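/- arXiv:math/0605342 — 2 statements merged into one kernel-verified Lean document; each statement's English description precedes it below -/
import Mathlib

section
/- Let V be a finite-dimensional real inner product space with inner product g, let J₊ and J₋ be complex structures on V compatible with g, let G : V → V* be the map x ↦ g(x, ·), and let F₊ = G ∘ J₊ and F₋ = G ∘ J₋. Then F₊ and F₋ are bijective, the bilinear forms (x, y) ↦ F₊(x)(y) and (x, y) ↦ F₋(x)(y) are alternating, and one has the identities −F₊⁻¹ + F₋⁻¹ = (J₊ − J₋) ∘ G⁻¹ and −F₊⁻¹ − F₋⁻¹ = (J₊ + J₋) ∘ G⁻¹. If moreover J₊ and J₋ commute, then the range of −F₊⁻¹ + F₋⁻¹ equals ker(J₊ + J₋) and the range of −F₊⁻¹ − F₋⁻¹ equals ker(J₊ − J₋). -/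
open RealInnerProductSpace

namespace LinearMap

/-- The inverse of `G ∘ J`, for a complex structure `J`, is `-J ∘ G⁻¹`. -/
theorem invFun_comp_of_comp_self_eq_neg_id {V W : Type*} [AddCommGroup V] [Module ℝ V]
    [AddCommGroup W] [Module ℝ W] {G : V →ₗ[ℝ] W} (hG : Function.Bijective G)
    {J : V →ₗ[ℝ] V} (hJ : J ∘ₗ J = -id) (hGJ : Function.Injective (G ∘ₗ J)) (ξ : W) :
    Function.invFun (G ∘ₗ J) ξ = -J (Function.invFun G ξ) := by
  have hJJ (x : V) : J (J x) = -x := LinearMap.congr_fun hJ x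
  obtain ⟨x, rfl⟩ := hG.surjective ξ
  have hx : G x = (G ∘ₗ J) (-J x) := by simp [hJJ]
  rw [Function.leftInverse_invFun hG.injective x, hx, Function.leftInverse_invFun hGJ]

theorem bijective_of_comp_self_eq_neg_id {V : Type*} [AddCommGroup V] [Module ℝ V]
    {J : V →ₗ[ℝ] V} (hJ : J ∘ₗ J = -id) : Function.Bijective J := by
  have hJJ (x : V) : J (J x) = -x := LinearMap.congr_fun hJ x
  exact Function.bijective_iff_has_inverse.2
    ⟨fun x => -J x, fun x => by simp [hJJ], fun x => by simp [hJJ]⟩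

/-- Commuting complex structures `J`, `K` satisfy `range (J - K) = ker (J + K)`. -/
theorem range_sub_eq_ker_add_of_comp_self_eq_neg_id {V : Type*} [AddCommGroup V] [Module ℝ V]
    {J K : V →ₗ[ℝ] V} (hJ : J ∘ₗ J = -id) (hK : K ∘ₗ K = -id) (hJK : J ∘ₗ K = K ∘ₗ J) :
    range (J - K) = ker (J + K) := by
  have hJJ (x : V) : J (J x) = -x := LinearMap.congr_fun hJ x
  have hKK (x : V) : K (K x) = -x := LinearMap.congr_fun hK x
  have hJK' (x : V) : J (K x) = K (J x) := LinearMap.congr_fun hJK x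
  ext x
  constructor
  · rintro ⟨y, rfl⟩
    simp [hJJ, hKK, hJK']
    abel
  · intro hx
    have hKx : K x = -J x := eq_neg_of_add_eq_zero_right (by simpa using hx)
    refine ⟨-(2⁻¹ : ℝ) • J x, ?_⟩
    have hKJ : K (J x) = x := by rw [← hJK', hKx, map_neg, hJJ, neg_neg]
    simp only [sub_apply, map_smul, hJJ, hKJ]
    module

theorem range_add_eq_ker_sub_of_comp_self_eq_neg_id {V : Type*} [AddCommGroup V] [Module ℝ V]
    {J K : V →ₗ[ℝ] V} (hJ : J ∘ₗ J = -id) (hK : K ∘ₗ K = -id) (hJK : J ∘ₗ K = K ∘ₗ J) :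
    range (J + K) = ker (J - K) := by
  simpa [← sub_eq_add_neg] using
    range_sub_eq_ker_add_of_comp_self_eq_neg_id (K := -K) hJ
      (by simpa [comp_neg, neg_comp] using hK) (by simp [comp_neg, neg_comp, hJK])

end LinearMap

/-- A complex structure compatible with the inner product is skew: `⟪J x, x⟫ = 0`. -/
theorem real_inner_self_eq_zero_of_comp_self_eq_neg_id {V : Type*} [NormedAddCommGroup V]
    [InnerProductSpace ℝ V] {J : V →ₗ[ℝ] V} (hJ : J ∘ₗ J = -LinearMap.id)
    (hg : ∀ x y : V, ⟪J x, J y⟫ = ⟪x, y⟫) (x : V) : ⟪J x, x⟫ = 0 := by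
  have h := hg (J x) x
  rw [show J (J x) = -x from LinearMap.congr_fun hJ x, inner_neg_left, real_inner_comm] at h
  linarith

/-- On a finite-dimensional space, the map `x ↦ ⟪x, ·⟫` to the dual is bijective. -/
theorem bijective_of_apply_eq_real_inner {V : Type*} [NormedAddCommGroup V]
    [InnerProductSpace ℝ V] [FiniteDimensional ℝ V] {G : V →ₗ[ℝ] Module.Dual ℝ V}
    (hG : ∀ x y : V, G x y = ⟪x, y⟫) : Function.Bijective G := by
  have hinj : Function.Injective G := (injective_iff_map_eq_zero G).2 fun x hx =>
    inner_self_eq_zero (𝕜 := ℝ).1 (by rw [← hG, hx, LinearMap.zero_apply])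
  exact ⟨hinj, (LinearMap.injective_iff_surjective_of_finrank_eq_finrank
    Subspace.dual_finrank_eq.symm).1 hinj⟩

/-- the fundamental forms `F± = G ∘ J±` are bijective and alternating, the
bivectors `-F₊⁻¹ ± F₋⁻¹` equal `(J₊ ∓ J₋) ∘ G⁻¹`, and when `J₊, J₋` commute their ranges
are the kernels of `J₊ + J₋` and `J₊ - J₋` respectively. -/
theorem stmt_3 (V : Type*) [NormedAddCommGroup V] [InnerProductSpace ℝ V]
    [FiniteDimensional ℝ V]
    (Jp Jm : V →ₗ[ℝ] V)
    (hJp : Jp ∘ₗ Jp = -LinearMap.id) (hJm : Jm ∘ₗ Jm = -LinearMap.id)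
    (hgp : ∀ x y : V, ⟪Jp x, Jp y⟫ = ⟪x, y⟫)
    (hgm : ∀ x y : V, ⟪Jm x, Jm y⟫ = ⟪x, y⟫)
    (G : V →ₗ[ℝ] Module.Dual ℝ V) (hG : ∀ x y : V, G x y = ⟪x, y⟫) :
    Function.Bijective ⇑(G ∘ₗ Jp) ∧ Function.Bijective ⇑(G ∘ₗ Jm) ∧
    (∀ x : V, (G ∘ₗ Jp) x x = 0) ∧ (∀ x : V, (G ∘ₗ Jm) x x = 0) ∧
    (∀ ξ : Module.Dual ℝ V,
      -(Function.invFun ⇑(G ∘ₗ Jp) ξ) + Function.invFun ⇑(G ∘ₗ Jm) ξ =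
        (Jp - Jm) (Function.invFun ⇑G ξ)) ∧
    (∀ ξ : Module.Dual ℝ V,
      -(Function.invFun ⇑(G ∘ₗ Jp) ξ) - Function.invFun ⇑(G ∘ₗ Jm) ξ =
        (Jp + Jm) (Function.invFun ⇑G ξ)) ∧
    (Jp ∘ₗ Jm = Jm ∘ₗ Jp →
      Set.range (fun ξ : Module.Dual ℝ V =>
          -(Function.invFun ⇑(G ∘ₗ Jp) ξ) + Function.invFun ⇑(G ∘ₗ Jm) ξ) =
        ↑(LinearMap.ker (Jp + Jm)) ∧
      Set.range (fun ξ : Module.Dual ℝ V =>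
          -(Function.invFun ⇑(G ∘ₗ Jp) ξ) - Function.invFun ⇑(G ∘ₗ Jm) ξ) =
        ↑(LinearMap.ker (Jp - Jm))) := by
  have hGb := bijective_of_apply_eq_real_inner hG
  have hFp : Function.Bijective ⇑(G ∘ₗ Jp) :=
    hGb.comp (LinearMap.bijective_of_comp_self_eq_neg_id hJp)
  have hFm : Function.Bijective ⇑(G ∘ₗ Jm) :=
    hGb.comp (LinearMap.bijective_of_comp_self_eq_neg_id hJm)
  have hsub (ξ : Module.Dual ℝ V) :
      -(Function.invFun ⇑(G ∘ₗ Jp) ξ) + Function.invFun ⇑(G ∘ₗ Jm) ξ =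
        (Jp - Jm) (Function.invFun ⇑G ξ) := by
    rw [LinearMap.invFun_comp_of_comp_self_eq_neg_id hGb hJp hFp.injective,
      LinearMap.invFun_comp_of_comp_self_eq_neg_id hGb hJm hFm.injective, LinearMap.sub_apply]
    abel
  have hadd (ξ : Module.Dual ℝ V) :
      -(Function.invFun ⇑(G ∘ₗ Jp) ξ) - Function.invFun ⇑(G ∘ₗ Jm) ξ =
        (Jp + Jm) (Function.invFun ⇑G ξ) := by
    rw [LinearMap.invFun_comp_of_comp_self_eq_neg_id hGb hJp hFp.injective,
      LinearMap.invFun_comp_of_comp_self_eq_neg_id hGb hJm hFm.injective, LinearMap.add_apply]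
    abel
  have hinv : Function.Surjective (Function.invFun ⇑G) := Function.invFun_surjective hGb.injective
  refine ⟨hFp, hFm, fun x => ?_, fun x => ?_, hsub, hadd, fun hcomm => ⟨?_, ?_⟩⟩
  · rw [LinearMap.comp_apply, hG, real_inner_self_eq_zero_of_comp_self_eq_neg_id hJp hgp]
  · rw [LinearMap.comp_apply, hG, real_inner_self_eq_zero_of_comp_self_eq_neg_id hJm hgm]
  · simp only [hsub]
    rw [← LinearMap.range_sub_eq_ker_add_of_comp_self_eq_neg_id hJp hJm hcomm,
      LinearMap.coe_range]
    exact hinv.range_comp (Jp - Jm)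
  · simp only [hadd]
    rw [← LinearMap.range_add_eq_ker_sub_of_comp_self_eq_neg_id hJp hJm hcomm,
      LinearMap.coe_range]
    exact hinv.range_comp (Jp + Jm)
end

section
/- Let V be a finite-dimensional real inner product space with inner product g, let J₊ and J₋ be complex structures on V compatible with g, let G : V → V* be x ↦ g(x, ·), and set F₊ = G ∘ J₊, F₋ = G ∘ J₋. Define 𝒥₁, 𝒥₂ : V ⊕ V* → V ⊕ V* by 𝒥₁(X, ξ) = ½((J₊ + J₋)X − (F₊⁻¹ − F₋⁻¹)(ξ), (F₊ − F₋)(X) − ξ ∘ (J₊ + J₋)) and 𝒥₂(X, ξ) = ½((J₊ − J₋)X − (F₊⁻¹ + F₋⁻¹)(ξ), (F₊ + F₋)(X) − ξ ∘ (J₊ − J₋)). Then 𝒥₁ ∘ 𝒥₁ = −id, 𝒥₂ ∘ 𝒥₂ = −id, both 𝒥₁ and 𝒥₂ preserve the natural pairing B, and 𝒥₁ ∘ 𝒥₂ = 𝒥₂ ∘ 𝒥₁. -/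
open RealInnerProductSpace

/-- If `F = G ∘ J` with `G` injective and `J` a complex structure, then `F⁻¹ (G u) = -J u`. -/
theorem invFun_comp_complexStructure {V W : Type*} [AddCommGroup V] [Module ℝ V]
    [AddCommGroup W] [Module ℝ W] {G : V →ₗ[ℝ] W} (hG : Function.Injective G)
    {J : V →ₗ[ℝ] V} (hJ : ∀ x, J (J x) = -x) (u : V) :
    Function.invFun ⇑(G ∘ₗ J) (G u) = -J u := by
  have hJinj : Function.Injective J := fun x y h => by
    simpa [hJ] using congrArg J h
  have hinj : Function.Injective ⇑(G ∘ₗ J) := by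
    simpa using hG.comp hJinj
  have hu : G u = (G ∘ₗ J) (-J u) := by simp [hJ]
  rw [hu]
  exact Function.leftInverse_invFun hinj _

/-- A complex structure compatible with the inner product is skew-adjoint. -/
theorem inner_complexStructure_right {V : Type*} [NormedAddCommGroup V] [InnerProductSpace ℝ V]
    {J : V →ₗ[ℝ] V} (hJ : ∀ x, J (J x) = -x) (hg : ∀ x y : V, ⟪J x, J y⟫ = ⟪x, y⟫) (x y : V) :
    ⟪x, J y⟫ = -⟪J x, y⟫ := by
  rw [← hg x (J y), hJ, inner_neg_right]

/-- The pairing on `V ⊕ V` given by `(X, u), (Y, v) ↦ ⟪u, Y⟫ + ⟪v, X⟫` is preserved by any map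
acting on `X + u` by an isometry `P` and on `X - u` by an isometry `M`. -/
theorem inner_add_inner_of_isometries {V : Type*} [NormedAddCommGroup V] [InnerProductSpace ℝ V]
    {P M : V →ₗ[ℝ] V} (hP : ∀ x y : V, ⟪P x, P y⟫ = ⟪x, y⟫)
    (hM : ∀ x y : V, ⟪M x, M y⟫ = ⟪x, y⟫) (X u Y v : V) :
    ⟪(1 / 2 : ℝ) • (P (X + u) - M (X - u)), (1 / 2 : ℝ) • (P (Y + v) + M (Y - v))⟫ +
      ⟪(1 / 2 : ℝ) • (P (Y + v) - M (Y - v)), (1 / 2 : ℝ) • (P (X + u) + M (X - u))⟫ =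
    ⟪u, Y⟫ + ⟪v, X⟫ := by
  have h1 := hP (X + u) (Y + v)
  have h2 := hM (X - u) (Y - v)
  generalize P (X + u) = a, P (Y + v) = b, M (X - u) = c, M (Y - v) = d at *
  simp only [inner_add_left, inner_add_right, inner_sub_left, inner_sub_right,
    real_inner_smul_left, real_inner_smul_right] at h1 h2 ⊢
  rw [real_inner_comm a b, real_inner_comm a d, real_inner_comm c b, real_inner_comm c d,
    real_inner_comm X v]
  linarith

/-- the Gualtieri maps `𝒥₁, 𝒥₂` built from a bi-Hermitian structure
`(g, J₊, J₋)` square to `-1`, preserve the natural pairing `B`, and commute. -/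
theorem stmt_7 (V : Type*) [NormedAddCommGroup V] [InnerProductSpace ℝ V]
    [FiniteDimensional ℝ V]
    (Jp Jm : V →ₗ[ℝ] V)
    (hJp : Jp ∘ₗ Jp = -LinearMap.id) (hJm : Jm ∘ₗ Jm = -LinearMap.id)
    (hgp : ∀ x y : V, ⟪Jp x, Jp y⟫ = ⟪x, y⟫)
    (hgm : ∀ x y : V, ⟪Jm x, Jm y⟫ = ⟪x, y⟫)
    (G : V →ₗ[ℝ] Module.Dual ℝ V) (hG : ∀ x y : V, G x y = ⟪x, y⟫)
    (B : V × Module.Dual ℝ V → V × Module.Dual ℝ V → ℝ)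
    (hB : ∀ w z : V × Module.Dual ℝ V, B w z = (w.2 z.1 + z.2 w.1) / 2)
    (J1 J2 : V × Module.Dual ℝ V → V × Module.Dual ℝ V)
    (hJ1 : ∀ (X : V) (ξ : Module.Dual ℝ V),
      J1 (X, ξ) =
        ((1 / 2 : ℝ) • ((Jp + Jm) X -
            (Function.invFun ⇑(G ∘ₗ Jp) ξ - Function.invFun ⇑(G ∘ₗ Jm) ξ)),
         (1 / 2 : ℝ) • (((G ∘ₗ Jp) X - (G ∘ₗ Jm) X) - ξ ∘ₗ (Jp + Jm))))
    (hJ2 : ∀ (X : V) (ξ : Module.Dual ℝ V),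
      J2 (X, ξ) =
        ((1 / 2 : ℝ) • ((Jp - Jm) X -
            (Function.invFun ⇑(G ∘ₗ Jp) ξ + Function.invFun ⇑(G ∘ₗ Jm) ξ)),
         (1 / 2 : ℝ) • (((G ∘ₗ Jp) X + (G ∘ₗ Jm) X) - ξ ∘ₗ (Jp - Jm)))) :
    (∀ w : V × Module.Dual ℝ V, J1 (J1 w) = -w) ∧
    (∀ w : V × Module.Dual ℝ V, J2 (J2 w) = -w) ∧
    (∀ w z : V × Module.Dual ℝ V, B (J1 w) (J1 z) = B w z) ∧
    (∀ w z : V × Module.Dual ℝ V, B (J2 w) (J2 z) = B w z) ∧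
    (∀ w : V × Module.Dual ℝ V, J1 (J2 w) = J2 (J1 w)) := by
  have hp : ∀ x, Jp (Jp x) = -x := fun x => by simpa using LinearMap.congr_fun hJp x
  have hm : ∀ x, Jm (Jm x) = -x := fun x => by simpa using LinearMap.congr_fun hJm x
  have hinj : Function.Injective G := fun x y h =>
    ext_inner_right ℝ fun z => by rw [← hG, ← hG, h]
  have hsurj : Function.Surjective G :=
    (LinearMap.injective_iff_surjective_of_finrank_eq_finrank
      Subspace.dual_finrank_eq.symm).1 hinj
  have hJ1' : ∀ X u : V, J1 (X, G u) =
      ((1 / 2 : ℝ) • (Jp (X + u) + Jm (X - u)), G ((1 / 2 : ℝ) • (Jp (X + u) - Jm (X - u)))) := by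
    intro X u
    rw [hJ1, invFun_comp_complexStructure hinj hp, invFun_comp_complexStructure hinj hm]
    refine Prod.ext ?_ (LinearMap.ext fun y => ?_)
    · simp only [LinearMap.add_apply, map_add, map_sub]
      module
    · simp [hG, inner_add_right,
        inner_complexStructure_right hp hgp, inner_complexStructure_right hm hgm]
      ring
  have hJ2' : ∀ X u : V, J2 (X, G u) =
      ((1 / 2 : ℝ) • (Jp (X + u) + (-Jm) (X - u)),
        G ((1 / 2 : ℝ) • (Jp (X + u) - (-Jm) (X - u)))) := by
    intro X u
    rw [hJ2, invFun_comp_complexStructure hinj hp, invFun_comp_complexStructure hinj hm]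
    refine Prod.ext ?_ (LinearMap.ext fun y => ?_)
    · simp only [LinearMap.sub_apply, LinearMap.neg_apply, map_add, map_sub]
      module
    · simp [hG, inner_sub_right,
        inner_complexStructure_right hp hgp, inner_complexStructure_right hm hgm]
      ring
  have hgm' : ∀ x y : V, ⟪(-Jm) x, (-Jm) y⟫ = ⟪x, y⟫ := fun x y => by simp [hgm]
  refine ⟨?_, ?_, ?_, ?_, ?_⟩
  · rintro ⟨X, ξ⟩
    obtain ⟨u, rfl⟩ := hsurj ξ
    rw [hJ1', hJ1', Prod.neg_mk, ← map_neg]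
    simp only [map_add, map_sub, map_smul, hp, hm]
    refine Prod.ext ?_ ?_ <;> dsimp only <;> module
  · rintro ⟨X, ξ⟩
    obtain ⟨u, rfl⟩ := hsurj ξ
    rw [hJ2', hJ2', Prod.neg_mk, ← map_neg]
    simp only [LinearMap.neg_apply, map_neg, map_add, map_sub, map_smul, hp, hm]
    refine Prod.ext ?_ ?_ <;> dsimp only <;> module
  · rintro ⟨X, ξ⟩ ⟨Y, η⟩
    obtain ⟨u, rfl⟩ := hsurj ξ
    obtain ⟨v, rfl⟩ := hsurj η
    simp only [hB, hJ1', hG, inner_add_inner_of_isometries hgp hgm]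
  · rintro ⟨X, ξ⟩ ⟨Y, η⟩
    obtain ⟨u, rfl⟩ := hsurj ξ
    obtain ⟨v, rfl⟩ := hsurj η
    simp only [hB, hJ2', hG, inner_add_inner_of_isometries hgp hgm']
  · rintro ⟨X, ξ⟩
    obtain ⟨u, rfl⟩ := hsurj ξ
    rw [hJ2', hJ1', hJ1', hJ2']
    simp only [LinearMap.neg_apply, map_neg, map_add, map_sub, map_smul, hp, hm]
    refine Prod.ext ?_ ?_ <;> dsimp only <;> module
end
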